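/- For all f, φ ∈ L²(ℝ) and every fixed x₂ ∈ ℝ, the coherent state transform satisfies ħ ∫_{ℝ²} |[W_φ f](x₁,x₂,x₃)|² dx₁ dx₃ = ‖f‖²_{L²(ℝ)} · ‖φ‖²_{L²(ℝ)}; in particular, for each fixed x₂ the map f ⊗ conj(φ) ↦ [W_φ f](·,x₂,·) is an isometry on L²(ℝ²) (with the measure ħ dx₁ dx₃ on the target). -/

import Mathlib

open MeasureTheory

/-- The induced coherent state transform W_φ f on 𝔾/Z ≃ ℝ³. -/
noncomputable def W (h₂ ℏ : ℝ) (φ f : ℝ → ℂ) (x : ℝ × ℝ × ℝ) : ℂ :=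
  Complex.exp (-(2 * Real.pi * Complex.I * h₂ * x.2.1)) *
    ∫ y : ℝ, f y * Complex.exp (-(2 * Real.pi * Complex.I * ℏ *
      (-(x.2.2 * y) + (1/2) * x.2.1 * y^2))) * star (φ (y - x.1))

theorem sq_int {α : Type*} [MeasurableSpace α] (μ : Measure α) (k : α → ℂ)
    (hk : AEStronglyMeasurable k μ) : ∫ x, ‖k x‖ ^ 2 ∂μ = (∫⁻ x, ‖k x‖ₑ ^ 2 ∂μ).toReal := by
  rw [integral_eq_lintegral_of_nonneg_ae (Filter.Eventually.of_forall fun x => by positivity)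
    (by fun_prop)]
  congr 2
  ext x
  rw [ENNReal.ofReal_pow (norm_nonneg _), ofReal_norm]

open scoped FourierTransform ContDiff SchwartzMap in
theorem planch_ae (g : ℝ → ℂ) (h1 : Integrable g) (h2 : MemLp g 2) :
    (𝓕 (h2.toLp g) : Lp ℂ 2 (volume : Measure ℝ)) =ᵐ[volume] 𝓕 g := by
  have hc : Continuous (𝓕 g) :=
    VectorFourier.fourierIntegral_continuous Real.continuous_fourierChar
      (by fun_prop) h1
  apply ae_eq_of_integral_contDiff_smul_eq
  · exact (Lp.memLp _).locallyIntegrable (by norm_num)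
  · exact hc.locallyIntegrable
  · intro u hu huc
    have hg₁ : HasCompactSupport (Complex.ofRealCLM ∘ u) := huc.comp_left rfl
    have hg₂ : ContDiff ℝ ∞ (Complex.ofRealCLM ∘ u) := by fun_prop
    set s : 𝓢(ℝ, ℂ) := hg₁.toSchwartzMap hg₂ with hs
    have e1 := congrArg (fun T => T s) (Lp.fourier_toTemperedDistribution_eq (h2.toLp g))
    simp only [TemperedDistribution.fourier_apply, Lp.toTemperedDistribution_apply] at e1
    have e2 : ∀ (k : ℝ → ℂ), ∫ x, u x • k x = ∫ x, s x • k x := by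
      intro k
      simp [hs]
    rw [e2, e2, ← e1]
    have e3 : ∫ x, (𝓕 s) x • (h2.toLp g) x = ∫ x, (𝓕 s) x • g x := by
      apply integral_congr_ae
      filter_upwards [h2.coeFn_toLp] with x hx
      rw [hx]
    rw [e3, SchwartzMap.fourier_coe]
    have := VectorFourier.integral_fourierIntegral_smul_eq_flip (L := innerₗ ℝ)
      Real.continuous_fourierChar (by fun_prop) s.integrable h1 (μ := volume) (ν := volume)
    convert! this using 1
    rw [flip_innerₗ]
    rfl

open scoped FourierTransform ENNReal in
theorem planch (g : ℝ → ℂ) (h1 : Integrable g) (h2 : MemLp g 2) :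
    ∫⁻ x, ‖𝓕 g x‖ₑ ^ 2 = ∫⁻ x, ‖g x‖ₑ ^ 2 := by
  have key : eLpNorm (𝓕 g) 2 volume = eLpNorm g 2 volume := by
    rw [← eLpNorm_congr_ae (planch_ae g h1 h2), ← eLpNorm_congr_ae h2.coeFn_toLp]
    have := Lp.norm_fourier_eq (h2.toLp g)
    rw [Lp.norm_def, Lp.norm_def] at this
    exact (ENNReal.toReal_eq_toReal_iff' (Lp.eLpNorm_ne_top _) (Lp.eLpNorm_ne_top _)).1 this
  have e : ∀ k : ℝ → ℂ, ∫⁻ x, ‖k x‖ₑ ^ 2 = eLpNorm k 2 volume ^ 2 := by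
    intro k
    have := eLpNorm_nnreal_pow_eq_lintegral (f := k) (p := 2) (μ := volume) (by norm_num)
    simpa using this.symm
  rw [e, e, key]

open scoped FourierTransform in
theorem W_eq (h₂ ℏ : ℝ) (f φ : ℝ → ℂ) (x₁ x₂ x₃ : ℝ) :
    ‖W h₂ ℏ φ f (x₁, x₂, x₃)‖ₑ = ‖𝓕 (fun y : ℝ => f y *
      Complex.exp (((-(Real.pi * ℏ * x₂ * y ^ 2) : ℝ) : ℂ) * Complex.I) * star (φ (y - x₁)))
      (-ℏ * x₃)‖ₑ := by
  unfold W
  have h0 : ‖Complex.exp (-(2 * Real.pi * Complex.I * h₂ * x₂))‖ₑ = 1 := by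
    rw [← ofReal_norm, show (-(2 * Real.pi * Complex.I * h₂ * x₂) : ℂ)
      = ((-(2 * Real.pi * h₂ * x₂) : ℝ) : ℂ) * Complex.I by push_cast; ring,
      Complex.norm_exp_ofReal_mul_I]
    simp
  rw [enorm_mul, h0, one_mul, Real.fourier_real_eq_integral_exp_smul]
  congr 1
  congr 1
  funext y
  have : Complex.exp (-(2 * Real.pi * Complex.I * ℏ * (-(x₃ * y) + (1/2) * x₂ * y^2)))
    = Complex.exp (((-2 * Real.pi * y * (-ℏ * x₃) : ℝ) : ℂ) * Complex.I) *
      Complex.exp (((-(Real.pi * ℏ * x₂ * y ^ 2) : ℝ) : ℂ) * Complex.I) := by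
    rw [← Complex.exp_add]
    congr 1
    push_cast
    ring
  simp only [this, smul_eq_mul]
  ring

open scoped ENNReal in
theorem main_meas (h₂ ℏ : ℝ) (hℏ : 0 < ℏ) (f φ : ℝ → ℂ)
    (hf : MemLp f 2 (volume : Measure ℝ)) (hφ : MemLp φ 2 (volume : Measure ℝ))
    (mf : Measurable f) (mφ : Measurable φ) (x₂ : ℝ) :
    ∫⁻ p : ℝ × ℝ, ‖W h₂ ℏ φ f (p.1, x₂, p.2)‖ₑ ^ 2
      = ENNReal.ofReal ℏ⁻¹ * ((∫⁻ y : ℝ, ‖f y‖ₑ ^ 2) * ∫⁻ y : ℝ, ‖φ y‖ₑ ^ 2) := by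
  have hfin : ∀ k : ℝ → ℂ, MemLp k 2 volume → ∫⁻ x, ‖k x‖ₑ ^ 2 ≠ ∞ := by
    intro k hk
    have := eLpNorm_nnreal_pow_eq_lintegral (f := k) (p := 2) (μ := volume) (by norm_num)
    have h3 : ∫⁻ x, ‖k x‖ₑ ^ 2 = eLpNorm k 2 volume ^ 2 := by simpa using this.symm
    rw [h3]
    exact ENNReal.pow_ne_top hk.2.ne
  have hT : ∫⁻ x₁ : ℝ, ∫⁻ y : ℝ, ‖f y‖ₑ ^ 2 * ‖φ (y - x₁)‖ₑ ^ 2 =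
      (∫⁻ y : ℝ, ‖f y‖ₑ ^ 2) * ∫⁻ y : ℝ, ‖φ y‖ₑ ^ 2 := by
    rw [lintegral_lintegral_swap (by fun_prop), ← lintegral_mul_const _ (by fun_prop)]
    congr 1
    ext y
    rw [lintegral_const_mul _ (by fun_prop)]
    congr 1
    exact lintegral_sub_left_eq_self (fun z => ‖φ z‖ₑ ^ 2) y
  have hae : ∀ᵐ x₁ : ℝ, ∫⁻ y : ℝ, ‖f y‖ₑ ^ 2 * ‖φ (y - x₁)‖ₑ ^ 2 < ∞ := by
    apply ae_lt_top
    · exact Measurable.lintegral_prod_right' (f := fun q : ℝ × ℝ => ‖f q.2‖ₑ ^ 2 * ‖φ (q.2 - q.1)‖ₑ ^ 2)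
        (by fun_prop)
    · rw [hT]
      exact ENNReal.mul_ne_top (hfin f hf) (hfin φ hφ)
  have mW : Measurable fun p : ℝ × ℝ => W h₂ ℏ φ f (p.1, x₂, p.2) := by
    unfold W
    dsimp only
    apply Measurable.const_mul
    apply StronglyMeasurable.measurable
    apply StronglyMeasurable.integral_prod_right' (f := fun q : (ℝ × ℝ) × ℝ =>
      f q.2 * Complex.exp (-(2 * Real.pi * Complex.I * ℏ *
      (-(q.1.2 * q.2) + (1/2) * x₂ * q.2^2))) * star (φ (q.2 - q.1.1)))
    apply Measurable.stronglyMeasurable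
    have : Measurable fun q : (ℝ × ℝ) × ℝ => star (φ (q.2 - q.1.1)) :=
      continuous_star.measurable.comp (mφ.comp (by fun_prop))
    fun_prop
  rw [Measure.volume_eq_prod, lintegral_prod _ (mW.enorm.pow_const 2).aemeasurable, ← hT,
    ← lintegral_const_mul' _ _ ENNReal.ofReal_ne_top]
  apply lintegral_congr_ae
  filter_upwards [hae] with x₁ hx
  set g : ℝ → ℂ := fun y : ℝ => f y *
      Complex.exp (((-(Real.pi * ℏ * x₂ * y ^ 2) : ℝ) : ℂ) * Complex.I) * star (φ (y - x₁)) with hg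
  have ng : ∀ y, ‖g y‖ₑ = ‖f y‖ₑ * ‖φ (y - x₁)‖ₑ := by
    intro y
    have : ‖Complex.exp (((-(Real.pi * ℏ * x₂ * y ^ 2) : ℝ) : ℂ) * Complex.I)‖ₑ = 1 := by
      rw [← ofReal_norm, Complex.norm_exp_ofReal_mul_I]
      simp
    have h' : ‖star (φ (y - x₁))‖ₑ = ‖φ (y - x₁)‖ₑ := by
      rw [← ofReal_norm, norm_star, ofReal_norm]
    simp only [hg, enorm_mul, this, h', mul_one]
  have mg : Measurable g := by
    have : Measurable fun y : ℝ => star (φ (y - x₁)) :=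
      continuous_star.measurable.comp (mφ.comp (by fun_prop))
    fun_prop
  have hφ' : MemLp (fun y => φ (y - x₁)) 2 volume :=
    hφ.comp_measurePreserving (measurePreserving_sub_right volume x₁)
  have h1 : Integrable g := by
    have : Integrable (fun y => f y * φ (y - x₁)) := hf.integrable_mul hφ'
    refine this.congr'_enorm mg.aestronglyMeasurable (Filter.Eventually.of_forall fun y => ?_)
    rw [ng, enorm_mul]
  have h2 : MemLp g 2 := by
    refine ⟨mg.aestronglyMeasurable, ?_⟩
    have := eLpNorm_nnreal_pow_eq_lintegral (f := g) (p := 2) (μ := volume) (by norm_num)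
    have h3 : eLpNorm g 2 volume ^ 2 = ∫⁻ x, ‖g x‖ₑ ^ 2 := by simpa using this
    have h4 : eLpNorm g 2 volume ^ 2 < ∞ := by
      rw [h3]
      simpa only [ng, mul_pow] using hx
    by_contra h5
    rw [not_lt, top_le_iff] at h5
    rw [h5] at h4
    simp at h4
  have hc : Continuous (FourierTransform.fourier g) :=
    VectorFourier.fourierIntegral_continuous Real.continuous_fourierChar
      (by fun_prop) h1
  simp only [W_eq, ← hg, ← mul_pow, ← ng]
  rw [← planch g h1 h2]
  have hm := Real.map_volume_mul_left (a := -ℏ) (by linarith)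
  have := lintegral_map (μ := volume) (f := fun z => ‖FourierTransform.fourier g z‖ₑ ^ 2)
    (g := fun x : ℝ => -ℏ * x) (by fun_prop) (by fun_prop)
  rw [← this, hm, lintegral_smul_measure, abs_inv, abs_neg, abs_of_pos hℏ, smul_eq_mul]

theorem main_meas' (h₂ ℏ : ℝ) (hℏ : 0 < ℏ) (f φ : ℝ → ℂ)
    (hf : MemLp f 2 (volume : Measure ℝ)) (hφ : MemLp φ 2 (volume : Measure ℝ))
    (mf : Measurable f) (mφ : Measurable φ) (x₂ : ℝ) :
    ℏ * ∫ p : ℝ × ℝ, ‖W h₂ ℏ φ f (p.1, x₂, p.2)‖^2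
      = (∫ y : ℝ, ‖f y‖^2) * ∫ y : ℝ, ‖φ y‖^2 := by
  have mW : Measurable fun p : ℝ × ℝ => W h₂ ℏ φ f (p.1, x₂, p.2) := by
    unfold W
    dsimp only
    apply Measurable.const_mul
    apply StronglyMeasurable.measurable
    apply StronglyMeasurable.integral_prod_right' (f := fun q : (ℝ × ℝ) × ℝ =>
      f q.2 * Complex.exp (-(2 * Real.pi * Complex.I * ℏ *
      (-(q.1.2 * q.2) + (1/2) * x₂ * q.2^2))) * star (φ (q.2 - q.1.1)))
    apply Measurable.stronglyMeasurable
    have : Measurable fun q : (ℝ × ℝ) × ℝ => star (φ (q.2 - q.1.1)) :=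
      continuous_star.measurable.comp (mφ.comp (by fun_prop))
    fun_prop
  rw [sq_int _ _ mW.aestronglyMeasurable, sq_int _ _ hf.1, sq_int _ _ hφ.1,
    main_meas h₂ ℏ hℏ f φ hf hφ mf mφ x₂, ENNReal.toReal_mul, ENNReal.toReal_mul,
    ENNReal.toReal_ofReal (by positivity), mul_inv_cancel_left₀ hℏ.ne']

theorem stmt4 (h₂ ℏ : ℝ) (hℏ : 0 < ℏ) (f φ : ℝ → ℂ)
    (hf : MemLp f 2 (volume : Measure ℝ)) (hφ : MemLp φ 2 (volume : Measure ℝ))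
    (x₂ : ℝ) :
    ℏ * ∫ p : ℝ × ℝ, ‖W h₂ ℏ φ f (p.1, x₂, p.2)‖^2
      = (∫ y : ℝ, ‖f y‖^2) * ∫ y : ℝ, ‖φ y‖^2 := by
  have ef := hf.1.ae_eq_mk
  have eφ := hφ.1.ae_eq_mk
  have key := main_meas' h₂ ℏ hℏ (hf.1.mk f) (hφ.1.mk φ) (hf.ae_eq ef) (hφ.ae_eq eφ)
    hf.1.stronglyMeasurable_mk.measurable hφ.1.stronglyMeasurable_mk.measurable x₂
  have eW : ∀ x, W h₂ ℏ φ f x = W h₂ ℏ (hφ.1.mk φ) (hf.1.mk f) x := by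
    intro x
    unfold W
    congr 1
    apply integral_congr_ae
    have e2 := (measurePreserving_sub_right volume x.1).quasiMeasurePreserving.ae_eq_comp eφ
    filter_upwards [ef, e2] with y hy hy2
    simp only [Function.comp] at hy2
    rw [← hy, hy2]
  simp only [eW]
  rw [key]
  congr 1
  · apply integral_congr_ae
    filter_upwards [ef] with y hy
    rw [← hy]
  · apply integral_congr_ae
    filter_upwards [eφ] with y hy
    rw [← hy]
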